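/- arXiv:1104.3831 — 7 statements merged into one kernel-verified Lean document; each statement's English description precedes it below -/
import Mathlib

section
/- Let n be a positive integer. Then every group of order n is cyclic (equivalently, the cyclic group Z_n is, up to isomorphism, the only group of order n) if and only if gcd(n, φ(n)) = 1. -/
theorem cyclic_unique_iff_gcd_totient (n : ℕ) (hn : 0 < n) :
    (∀ (G : Type) [Group G] [Fintype G], Fintype.card G = n → IsCyclic G) ↔
      Nat.gcd n (Nat.totient n) = 1 := by
  constructor
  · intro h
    by_contra hg
    obtain ⟨p, hp, hpn, hpt⟩ := Nat.Prime.not_coprime_iff_dvd.mp hg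
    have := Fact.mk hp
    obtain ⟨m, rfl⟩ := hpn
    have hm : 0 < m := Nat.pos_of_mul_pos_left hn
    have : NeZero m := ⟨hm.ne'⟩
    by_cases hpm : p ∣ m
    · have hc := h (Multiplicative (ZMod p) × Multiplicative (ZMod m)) (by simp [ZMod.card])
      have h2 := ((Group.isCyclic_prod_iff).mp hc).2.2
      replace h2 : p.Coprime m := by simpa using h2
      exact hp.one_lt.ne' (Nat.Coprime.eq_one_of_dvd h2 hpm)
    · have hcop : p.Coprime m := (Nat.Prime.coprime_iff_not_dvd hp).mpr hpm
      rw [Nat.totient_mul hcop, Nat.totient_prime hp] at hpt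
      have hpm' : p ∣ Nat.totient m := by
        rcases (Nat.Prime.dvd_mul hp).mp hpt with h1 | h1
        · have := Nat.le_of_dvd (by have := hp.two_le; omega) h1
          have := hp.two_le
          omega
        · exact h1
      have hcard : Nat.card (MulAut (Multiplicative (ZMod m))) = Nat.totient m := by
        rw [IsCyclic.card_mulAut]; simp
      rw [← hcard] at hpm'
      obtain ⟨a, ha⟩ := exists_prime_orderOf_dvd_card' p hpm'
      let S := Multiplicative (ZMod m) ⋊[(Subgroup.zpowers a).subtype] Subgroup.zpowers a
      have hS : Nat.card S = p * m := by
        rw [SemidirectProduct.card, Nat.card_zpowers, ha]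
        simp [mul_comm]
      have : Finite S := Nat.finite_of_card_ne_zero (by rw [hS]; exact hn.ne')
      have : Fintype S := Fintype.ofFinite S
      have hc := h S (by rw [← Nat.card_eq_fintype_card, hS])
      have ha1 : a = 1 := by
        ext x
        have h3 := SemidirectProduct.inl_aut (φ := (Subgroup.zpowers a).subtype)
          ⟨a, Subgroup.mem_zpowers a⟩ x
        let _ : CommGroup S := IsCyclic.commGroup
        have h4 : ∀ u v : S, u * v = v * u := fun u v => mul_comm u v
        rw [h4, ← mul_assoc, ← map_mul, inv_mul_cancel, map_one, one_mul] at h3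
        exact congrArg _ (SemidirectProduct.inl_injective h3)
      rw [ha1, orderOf_one] at ha
      exact hp.one_lt.ne ha
  · intro hg G _ _ hG
    have hG' : Nat.card G = n := by rw [Nat.card_eq_fintype_card, hG]
    have hsq : Squarefree n := by
      rw [Nat.squarefree_iff_prime_squarefree]
      rintro p hp ⟨k, rfl⟩
      refine Nat.Prime.not_coprime_iff_dvd.mpr ⟨p, hp, ?_, ?_⟩ hg
      · exact ⟨p * k, by ring⟩
      · rw [mul_assoc, Nat.totient_mul_of_prime_of_dvd hp (dvd_mul_right _ _)]
        exact dvd_mul_right _ _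
    have : IsZGroup G := IsZGroup.of_squarefree (hG' ▸ hsq)
    have hK := IsZGroup.isCyclic_commutator G
    have hle : commutator G ≤ Subgroup.center G := by
      have hcop : (Nat.card G).Coprime (Nat.card (MulAut (commutator G))) := by
        rw [IsCyclic.card_mulAut, hG']
        exact Nat.Coprime.coprime_dvd_right
          (Nat.totient_dvd_of_dvd (hG' ▸ Subgroup.card_subgroup_dvd_card _)) hg
      intro k hk
      rw [Subgroup.mem_center_iff]
      intro g
      have h1 : (MulAut.conjNormal g : MulAut (commutator G)) = 1 := by
        rw [← orderOf_eq_one_iff]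
        exact Nat.eq_one_of_dvd_coprimes hcop
          ((orderOf_map_dvd _ g).trans (orderOf_dvd_natCard g)) (orderOf_dvd_natCard _)
      have h2 := MulAut.conjNormal_apply g (⟨k, hk⟩ : commutator G)
      rw [h1] at h2
      exact (eq_mul_inv_iff_mul_eq.mp h2).symm
    rw [← Abelianization.ker_of G] at hle
    let _ := commGroupOfCyclicCenterQuotient Abelianization.of hle
    infer_instance
end

section
/- Let n be a positive integer such that every group of order n is cyclic. Then gcd(n, φ(n)) = 1. -/
theorem gcd_totient_eq_one_of_all_groups_cyclic (n : ℕ) (hn : 0 < n)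
    (h : ∀ (G : Type) [Group G] [Fintype G], Fintype.card G = n → IsCyclic G) :
    Nat.gcd n (Nat.totient n) = 1 := by
  have h' : ∀ (G : Type) [Group G], Nat.card G = n → IsCyclic G := by
    intro G _ hG
    have : Finite G := Nat.finite_of_card_ne_zero (by omega)
    have := Fintype.ofFinite G
    exact h G (by rw [← Nat.card_eq_fintype_card, hG])
  by_contra hne
  obtain ⟨p, hp, hpg⟩ := Nat.exists_prime_and_dvd hne
  have hpn := hpg.trans (Nat.gcd_dvd_left _ _)
  have hpt := hpg.trans (Nat.gcd_dvd_right _ _)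
  obtain ⟨m, rfl⟩ := hpn
  have hm : 0 < m := Nat.pos_of_mul_pos_left hn
  have : NeZero m := ⟨hm.ne'⟩
  have : NeZero p := ⟨hp.ne_zero⟩
  have : Fact p.Prime := ⟨hp⟩
  have hco : Nat.Coprime p m := by
    have hc := h' (Multiplicative (ZMod p) × Multiplicative (ZMod m)) (by simp)
    have := (Group.isCyclic_prod_iff.1 hc).2.2
    simpa using this
  rw [Nat.totient_mul hco, Nat.totient_prime hp] at hpt
  have hpm : p ∣ Nat.totient m := by
    rcases hp.dvd_mul.1 hpt with h1 | h1
    · have := Nat.le_of_dvd (by have := hp.two_le; omega) h1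
      have := hp.two_le
      omega
    · exact h1
  have hcard : Nat.card (MulAut (Multiplicative (ZMod m))) = Nat.totient m := by
    rw [IsCyclic.card_mulAut]; simp
  have : Finite (MulAut (Multiplicative (ZMod m))) :=
    Nat.finite_of_card_ne_zero (by rw [hcard]; exact (Nat.totient_pos.2 hm).ne')
  obtain ⟨u, hu⟩ := exists_prime_orderOf_dvd_card' (G := MulAut (Multiplicative (ZMod m))) p
    (by rw [hcard]; exact hpm)
  have hc := h' (Multiplicative (ZMod m) ⋊[(Subgroup.zpowers u).subtype] (Subgroup.zpowers u)) (by
    rw [SemidirectProduct.card, Nat.card_zpowers, hu]; simp [mul_comm])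
  have hu1 : u = 1 := by
    ext x : 1
    let g : Subgroup.zpowers u := ⟨u, Subgroup.mem_zpowers u⟩
    have h1 := SemidirectProduct.inl_aut (φ := (Subgroup.zpowers u).subtype) g x
    rw [hc.isMulCommutative.is_comm.comm (SemidirectProduct.inr g), mul_assoc, ← map_mul, mul_inv_cancel, map_one,
      mul_one] at h1
    exact SemidirectProduct.inl_injective h1
  rw [hu1, orderOf_one] at hu
  exact hp.one_lt.ne hu
end

section
/- Let n be a positive integer with gcd(n, φ(n)) = 1. Then every finite group of order n is cyclic (hence isomorphic to ZMod n). -/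
theorem isCyclic_of_gcd_totient_eq_one (n : ℕ) (hn : 0 < n)
    (h : Nat.gcd n (Nat.totient n) = 1)
    (G : Type) [Group G] [Fintype G] (hG : Fintype.card G = n) :
    IsCyclic G ∧ Nonempty (G ≃* Multiplicative (ZMod n)) := by
  have hcard : Nat.card G = n := by rw [Nat.card_eq_fintype_card, hG]
  have hsq : Squarefree n := by
    rw [Nat.squarefree_iff_prime_squarefree]
    intro p hp hpp
    have h1 : p ∣ Nat.totient n := by
      refine dvd_trans ?_ (Nat.totient_dvd_of_dvd hpp)
      rw [Nat.totient_mul_of_prime_of_dvd hp dvd_rfl]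
      exact dvd_mul_right _ _
    have h2 : p ∣ Nat.gcd n (Nat.totient n) :=
      Nat.dvd_gcd ((dvd_mul_right p p).trans hpp) h1
    rw [h] at h2
    exact hp.one_lt.ne' (Nat.dvd_one.mp h2)
  have hZ : IsZGroup G := IsZGroup.of_squarefree (hcard ▸ hsq)
  have hC : IsCyclic (commutator G) := hZ.isCyclic_commutator
  have hcent : commutator G ≤ Subgroup.center G := by
    have hAut : Nat.card (MulAut (commutator G)) = Nat.totient (Nat.card (commutator G)) := by
      have hne : NeZero (Nat.card (commutator G)) := ⟨Nat.card_pos.ne'⟩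
      rw [Nat.card_congr (hC.mulAutMulEquiv _).toEquiv, Nat.card_eq_fintype_card,
        ZMod.card_units_eq_totient]
    have htriv : ∀ g : G, (MulAut.conjNormal g : MulAut (commutator G)) = 1 := by
      intro g
      rw [← orderOf_eq_one_iff, ← Nat.dvd_one, ← h]
      refine Nat.dvd_gcd ?_ ?_
      · rw [← hcard]
        exact (orderOf_map_dvd _ g).trans (orderOf_dvd_natCard g)
      · refine (orderOf_dvd_natCard _).trans ?_
        rw [hAut]
        exact Nat.totient_dvd_of_dvd (hcard ▸ Subgroup.card_subgroup_dvd_card _)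
    intro c hc
    rw [Subgroup.mem_center_iff]
    intro g
    have h1 := MulAut.conjNormal_apply (H := commutator G) g ⟨c, hc⟩
    rw [htriv g] at h1
    have h2 : c = g * c * g⁻¹ := h1
    exact (eq_mul_inv_iff_mul_eq.mp h2).symm
  have hcyc : IsCyclic G := by
    rw [← Abelianization.ker_of G] at hcent
    let _ := commGroupOfCyclicCenterQuotient Abelianization.of hcent
    infer_instance
  exact ⟨hcyc, ⟨(hcard ▸ (zmodCyclicMulEquiv hcyc).symm)⟩⟩
end

section
/- Let G be a finite group whose order is squarefree (i.e., |G| = p_1 p_2 ⋯ p_s is a product of distinct primes). Then G is solvable. -/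
theorem isSolvable_of_squarefree_card (G : Type*) [Group G] [Fintype G]
    (h : Squarefree (Fintype.card G)) : IsSolvable G := by
  have : IsZGroup G := IsZGroup.of_squarefree (by rwa [Nat.card_eq_fintype_card])
  exact (inferInstance : Group.IsSolvable G)
end

section
/- Let n be a squarefree positive integer with gcd(n, φ(n)) ≠ 1. Then there exists a non-abelian group of order n. -/
theorem exists_nonabelian_group_of_squarefree_gcd_ne_one (n : ℕ) (hn : 0 < n)
    (hsf : Squarefree n) (h : Nat.gcd n (Nat.totient n) ≠ 1) :
    ∃ (G : Type) (_ : Group G) (_ : Fintype G),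
      Fintype.card G = n ∧ ∃ a b : G, a * b ≠ b * a := by
  obtain ⟨p, hp, hpd⟩ := Nat.exists_prime_and_dvd h
  have hpn := hpd.trans (Nat.gcd_dvd_left _ _)
  have hpt := hpd.trans (Nat.gcd_dvd_right _ _)
  obtain ⟨m, rfl⟩ := hpn
  have hcop : Nat.Coprime p m := Nat.coprime_of_squarefree_mul hsf
  have hm : m ≠ 0 := by rintro rfl; simp at hn
  haveI : NeZero m := ⟨hm⟩
  haveI : Fact p.Prime := ⟨hp⟩
  rw [Nat.totient_mul hcop, Nat.totient_prime hp] at hpt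
  have hpm : p ∣ Nat.totient m := by
    rcases (Nat.Prime.dvd_mul hp).1 hpt with h1 | h1
    · have h2 := Nat.le_of_dvd (by have := hp.two_le; omega) h1
      have := hp.two_le
      omega
    · exact h1
  -- a unit of order `p` modulo `m`
  obtain ⟨u, hu⟩ := exists_prime_orderOf_dvd_card (G := (ZMod m)ˣ) p
    (by rwa [ZMod.card_units_eq_totient])
  let f : Subgroup.zpowers u →* MulAut (Multiplicative (ZMod m)) :=
    ((MulAutMultiplicative (ZMod m)).symm.toMonoidHom.comp
      (AddAut.mulLeft (R := ZMod m))).comp (Subgroup.zpowers u).subtype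
  have hcard : Nat.card (Multiplicative (ZMod m) ⋊[f] Subgroup.zpowers u) = p * m := by
    rw [SemidirectProduct.card, Nat.card_zpowers, hu, mul_comm]
    simp
  haveI : Finite (Multiplicative (ZMod m) ⋊[f] Subgroup.zpowers u) :=
    Nat.finite_of_card_ne_zero (by rw [hcard]; exact hn.ne')
  refine ⟨Multiplicative (ZMod m) ⋊[f] Subgroup.zpowers u, inferInstance,
    Fintype.ofFinite _, ?_, SemidirectProduct.inr ⟨u, Subgroup.mem_zpowers u⟩,
    SemidirectProduct.inl (Multiplicative.ofAdd 1), ?_⟩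
  · rw [← hcard, @Nat.card_eq_fintype_card _ (Fintype.ofFinite _)]
  · intro hc
    have h1 := congrArg SemidirectProduct.left hc
    have h2 : (u : ZMod m) * 1 = 1 := by
      have h3 : f ⟨u, Subgroup.mem_zpowers u⟩ (Multiplicative.ofAdd 1)
          = Multiplicative.ofAdd 1 := by simpa using h1
      exact h3
    have h4 : u = 1 := Units.ext (by simpa using h2)
    rw [h4, orderOf_one] at hu
    exact hp.one_lt.ne hu
end

section
/- Let G be a finite group whose order n > 1 is squarefree, and write n = m·p where p is a prime divisor of n and m = n/p. Then G has a normal subgroup H of order m and a subgroup K of order p, for some prime divisor p of n. -/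
open scoped IsMulCommutative in
theorem exists_normal_subgroup_of_squarefree_card (G : Type*) [Group G] [Fintype G]
    (h1 : 1 < Fintype.card G) (hsf : Squarefree (Fintype.card G)) :
    ∃ p : ℕ, p.Prime ∧ p ∣ Fintype.card G ∧
      (∃ H : Subgroup G, H.Normal ∧ Nat.card H = Fintype.card G / p) ∧
      (∃ K : Subgroup G, Nat.card K = p) := by
  rw [← Nat.card_eq_fintype_card] at *
  have hp : (Nat.card G).minFac.Prime := Nat.minFac_prime h1.ne'
  have := Fact.mk hp
  let P : Sylow (Nat.card G).minFac G := default
  have hz : IsZGroup G := IsZGroup.of_squarefree hsf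
  have hP : IsCyclic P := hz.isZGroup _ hp P
  have hc : Nat.card P = (Nat.card G).minFac := by
    have h := P.card_eq_multiplicity
    have h2 : (Nat.card G).factorization (Nat.card G).minFac = 1 :=
      le_antisymm (hsf.natFactorization_le_one _)
        (hp.factorization_pos_of_dvd (by omega) (Nat.minFac_dvd _))
    rwa [h2, pow_one] at h
  refine ⟨_, hp, Nat.minFac_dvd _, ⟨_, MonoidHom.normal_ker
    (MonoidHom.transferSylow P (hP.normalizer_le_centralizer rfl)), ?_⟩, P, hc⟩
  have h := (hP.isComplement' rfl).card_mul_card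
  refine (Nat.div_eq_of_eq_mul_left hp.pos ?_).symm
  exact h.symm.trans (congrArg _ hc)
end

section
/- Let m and p be coprime positive integers with gcd(m·p, φ(m·p)) = 1, and suppose every group of order m is cyclic. If G is a group of order m·p possessing a normal subgroup H of order m and a subgroup K of order p, then G is cyclic. -/
theorem squarefree_of_coprime_totient {n : ℕ} (h : Nat.Coprime n (Nat.totient n)) :
    Squarefree n := by
  rw [Nat.squarefree_iff_prime_squarefree]
  intro q hq hd
  have h1 : q ∣ Nat.totient n := by
    have h2 := Nat.totient_dvd_of_dvd hd
    rw [Nat.totient_mul_of_prime_of_dvd hq dvd_rfl] at h2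
    exact (dvd_mul_right _ _).trans h2
  exact Nat.not_coprime_of_dvd_of_dvd hq.one_lt ((dvd_mul_right _ _).trans hd) h1 h

theorem isCyclic_of_coprime_totient {G : Type*} [Group G] [Finite G]
    (h : Nat.Coprime (Nat.card G) (Nat.totient (Nat.card G))) : IsCyclic G := by
  have hz : IsZGroup G := IsZGroup.of_squarefree (squarefree_of_coprime_totient h)
  have hc : IsCyclic (commutator G) := IsZGroup.isCyclic_commutator G
  have hcard : Nat.card (MulAut (commutator G)) ∣ Nat.totient (Nat.card G) := by
    rw [IsCyclic.card_mulAut]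
    exact Nat.totient_dvd_of_dvd (Subgroup.card_subgroup_dvd_card _)
  have htriv : ∀ g : G, (MulAut.conjNormal g : MulAut (commutator G)) = 1 := by
    intro g
    rw [← orderOf_eq_one_iff]
    refine Nat.eq_one_of_dvd_coprimes h ?_ ((orderOf_dvd_natCard _).trans hcard)
    exact (orderOf_map_dvd _ g).trans (orderOf_dvd_natCard g)
  have hcen : (Abelianization.of (G := G)).ker ≤ Subgroup.center G := by
    rw [Abelianization.ker_of]
    intro x hx
    rw [Subgroup.mem_center_iff]
    intro g
    have h1 := MulAut.conjNormal_apply g (⟨x, hx⟩ : commutator G)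
    rw [htriv g] at h1
    simp only [MulAut.one_apply] at h1
    exact (eq_mul_inv_iff_mul_eq.mp h1).symm
  let _ := commGroupOfCyclicCenterQuotient Abelianization.of hcen
  infer_instance

theorem isCyclic_of_normal_subgroup_and_complement (m p : ℕ) (hm : 0 < m) (hp : 0 < p)
    (hcop : Nat.Coprime m p) (hgcd : Nat.gcd (m * p) (Nat.totient (m * p)) = 1)
    (hcyc : ∀ (H : Type) [Group H] [Fintype H], Fintype.card H = m → IsCyclic H)
    (G : Type*) [Group G] [Fintype G] (hG : Fintype.card G = m * p)
    (H : Subgroup G) (hHn : H.Normal) (hHm : Nat.card H = m)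
    (K : Subgroup G) (hKp : Nat.card K = p) : IsCyclic G := by
  apply isCyclic_of_coprime_totient
  rw [Nat.card_eq_fintype_card, hG]
  exact hgcd
end
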